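/- Let i ∈ ℕ, let w : ℕ → ℝ be nonnegative and nondecreasing, let z : ℕ → ℝ be positive and nondecreasing, and define p(t) := min(1, min_{i ≤ s ≤ t} w(s)/z(s)) for t ≥ i. If i ≤ t₁ ≤ t₂ and w(s) = w(t₁) for all s with t₁ ≤ s ≤ t₂ (the weight is constant on [t₁, t₂]), then p(t₂) = min(p(t₁), w(t₂)/z(t₂)). In particular, during intervals of constant weight, the ratio w(s)/z(s) is nonincreasing and updates of p may be deferred to the endpoint. -/

import Mathlib

/-- Let `w : ℕ → ℝ` be nonnegative and nondecreasing, `z : ℕ → ℝ` positive and nondecreasing, and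
for `t ≥ i` let `p t = min 1 (min_{i ≤ s ≤ t} (w s / z s))`.  If `i ≤ t₁ ≤ t₂` and the weight
`w` is constant on `[t₁, t₂]`, then the ratio `w s / z s` is nonincreasing on `[t₁, t₂]` and
`p t₂ = min (p t₁) (w t₂ / z t₂)`: updates of `p` may be deferred to the end of intervals of
constant weight. -/
theorem deferred_probability_update (i : ℕ) (w z : ℕ → ℝ)
    (hw0 : ∀ t, 0 ≤ w t) (hwmono : Monotone w)
    (hz : ∀ t, 0 < z t) (hzmono : Monotone z)
    (t₁ t₂ : ℕ) (h1 : i ≤ t₁) (h2 : t₁ ≤ t₂)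
    (hconst : ∀ s, t₁ ≤ s → s ≤ t₂ → w s = w t₁) :
    (∀ s₁ s₂, t₁ ≤ s₁ → s₁ ≤ s₂ → s₂ ≤ t₂ → w s₂ / z s₂ ≤ w s₁ / z s₁)
    ∧ min 1 ((Finset.Icc i t₂).inf' (Finset.nonempty_Icc.mpr (h1.trans h2))
          (fun s => w s / z s))
      = min (min 1 ((Finset.Icc i t₁).inf' (Finset.nonempty_Icc.mpr h1)
          (fun s => w s / z s))) (w t₂ / z t₂) := by
  have hratio : ∀ s₁ s₂, t₁ ≤ s₁ → s₁ ≤ s₂ → s₂ ≤ t₂ → w s₂ / z s₂ ≤ w s₁ / z s₁ := by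
    intro s₁ s₂ hs₁ hs hs₂
    rw [hconst s₂ (hs₁.trans hs) hs₂, hconst s₁ hs₁ (hs.trans hs₂)]
    exact div_le_div_of_nonneg_left (hw0 t₁) (hz s₁) (hzmono hs)
  refine ⟨hratio, ?_⟩
  rw [min_assoc]
  congr 1
  apply le_antisymm
  · refine le_min (Finset.inf'_mono _ (Finset.Icc_subset_Icc_right h2) _) ?_
    exact Finset.inf'_le _ (Finset.mem_Icc.mpr ⟨h1.trans h2, le_rfl⟩)
  · refine Finset.le_inf' _ _ fun s hs => ?_
    obtain ⟨his, hst⟩ := Finset.mem_Icc.mp hs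
    rcases le_total s t₁ with h | h
    · exact (min_le_left _ _).trans (Finset.inf'_le _ (Finset.mem_Icc.mpr ⟨his, h⟩))
    · exact (min_le_right _ _).trans (hratio s t₂ h hst le_rfl)
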